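/- A connected graph G is an arborescence if and only if G is C4-free and P4-free. -/

import Mathlib

/-- A strict partial order (irreflexive and transitive relation). -/
def IsStrictPO {V : Type*} (lt : V → V → Prop) : Prop :=
  (∀ a, ¬ lt a a) ∧ ∀ a b c, lt a b → lt b c → lt a c

/-- `b` covers `a` in the strict order `lt`. -/
def CovRel {V : Type*} (lt : V → V → Prop) (a b : V) : Prop :=
  lt a b ∧ ∀ c, lt a c → ¬ lt c b

/-- The Hasse diagram of a strict order: vertices joined iff one covers the other. -/
def hasseGraph {V : Type*} (lt : V → V → Prop) : SimpleGraph V :=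
  SimpleGraph.fromRel (CovRel lt)

/-- `lt` is a treelike orientation of `G`: a transitive orientation
(a strict partial order in which distinct vertices are adjacent iff comparable)
whose Hasse diagram is a tree. -/
def IsTreelikeOrientation {V : Type*} (G : SimpleGraph V) (lt : V → V → Prop) : Prop :=
  IsStrictPO lt ∧ (∀ a b : V, G.Adj a b ↔ (lt a b ∨ lt b a)) ∧ (hasseGraph lt).IsTree

/-- A treelike comparability graph: a graph admitting a treelike orientation. -/
def IsTreelikeComparability {V : Type*} (G : SimpleGraph V) : Prop :=
  ∃ lt : V → V → Prop, IsTreelikeOrientation G lt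

/-- A double-arborescence: a treelike comparability graph with an all-adjacent vertex. -/
def IsDoubleArborescence {V : Type*} (G : SimpleGraph V) : Prop :=
  IsTreelikeComparability G ∧ ∃ r : V, ∀ v : V, v ≠ r → G.Adj r v

/-- An arborescence: a treelike comparability graph admitting a treelike orientation
in which some vertex is the greatest or the least element. -/
def IsArborescence {V : Type*} (G : SimpleGraph V) : Prop :=
  ∃ lt : V → V → Prop, IsTreelikeOrientation G lt ∧
    ∃ r : V, (∀ v : V, v ≠ r → lt v r) ∨ (∀ v : V, v ≠ r → lt r v)

/-- `G` contains an induced path on four vertices. -/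
def HasInducedP4 {V : Type*} (G : SimpleGraph V) : Prop :=
  ∃ a b c d : V, a ≠ b ∧ a ≠ c ∧ a ≠ d ∧ b ≠ c ∧ b ≠ d ∧ c ≠ d ∧
    G.Adj a b ∧ G.Adj b c ∧ G.Adj c d ∧ ¬ G.Adj a c ∧ ¬ G.Adj a d ∧ ¬ G.Adj b d

/-- `G` is `P4`-free. -/
def P4Free {V : Type*} (G : SimpleGraph V) : Prop := ¬ HasInducedP4 G

/-- `G` contains an induced cycle on four vertices. -/
def HasInducedC4 {V : Type*} (G : SimpleGraph V) : Prop :=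
  ∃ a b c d : V, a ≠ b ∧ a ≠ c ∧ a ≠ d ∧ b ≠ c ∧ b ≠ d ∧ c ≠ d ∧
    G.Adj a b ∧ G.Adj b c ∧ G.Adj c d ∧ G.Adj d a ∧ ¬ G.Adj a c ∧ ¬ G.Adj b d

/-- `G` is `C4`-free. -/
def C4Free {V : Type*} (G : SimpleGraph V) : Prop := ¬ HasInducedC4 G

section TreeOrders

variable {V : Type*} {lt : V → V → Prop}

lemma IsStrictPO.swap (h : IsStrictPO lt) : IsStrictPO (fun a b => lt b a) :=
  ⟨h.1, fun a b c hab hbc => h.2 c b a hbc hab⟩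

lemma IsStrictPO.wellFounded [Finite V] (h : IsStrictPO lt) : WellFounded lt := by
  have : Std.Irrefl lt := ⟨h.1⟩
  have : IsTrans V lt := ⟨h.2⟩
  exact Finite.wellFounded_of_trans_of_irrefl lt

lemma hasseGraph_adj (h : IsStrictPO lt) {a b : V} :
    (hasseGraph lt).Adj a b ↔ CovRel lt a b ∨ CovRel lt b a := by
  simp only [hasseGraph, SimpleGraph.fromRel_adj, and_iff_right_iff_imp]
  rintro (hab | hab) rfl <;> exact h.1 _ hab.1

lemma hasseGraph_swap : hasseGraph (fun a b => lt b a) = hasseGraph lt := by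
  ext a b
  simp only [hasseGraph, SimpleGraph.fromRel_adj, CovRel]
  grind

lemma IsTreelikeOrientation.swap {G : SimpleGraph V} (h : IsTreelikeOrientation G lt) :
    IsTreelikeOrientation G (fun a b => lt b a) :=
  ⟨h.1.swap, fun a b => (h.2.1 a b).trans or_comm, hasseGraph_swap (lt := lt) ▸ h.2.2⟩

/-- Below any strict upper bound of `a` there is a lower cover that is still at least `a`. -/
lemma IsStrictPO.exists_covRel [Finite V] (h : IsStrictPO lt) {a c : V} (hac : lt a c) :
    ∃ p, (a = p ∨ lt a p) ∧ CovRel lt p c := by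
  obtain ⟨p, ⟨hap, hpc⟩, hmax⟩ := h.swap.wellFounded.has_min
    {x | (a = x ∨ lt a x) ∧ lt x c} ⟨a, Or.inl rfl, hac⟩
  refine ⟨p, hap, hpc, fun d hpd hdc => hmax d ⟨Or.inr ?_, hdc⟩ hpd⟩
  rcases hap with rfl | hap
  · exact hpd
  · exact h.2 _ _ _ hap hpd

/-- Every vertex is joined to the least element by a path in the Hasse diagram that stays
below the vertex. -/
lemma IsStrictPO.exists_isPath_from_least [Finite V] (h : IsStrictPO lt) {r : V}
    (hr : ∀ v, v ≠ r → lt r v) (x : V) :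
    ∃ p : (hasseGraph lt).Walk r x, p.IsPath ∧ ∀ y ∈ p.support, y = x ∨ lt y x := by
  induction x using h.wellFounded.induction with
  | _ x ih =>
    by_cases hx : x = r
    · subst hx
      exact ⟨SimpleGraph.Walk.nil, SimpleGraph.Walk.IsPath.nil, by simp⟩
    · obtain ⟨q, -, hq⟩ := h.exists_covRel (hr x hx)
      obtain ⟨p, hp, hle⟩ := ih q hq.1
      have hlt : ∀ y ∈ p.support, lt y x := fun y hy => by
        rcases hle y hy with rfl | hy
        · exact hq.1
        · exact h.2 _ _ _ hy hq.1
      refine ⟨p.concat ((hasseGraph_adj h).2 (Or.inl hq)),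
        hp.concat (fun hx => h.1 _ (hlt x hx)) _, fun y hy => ?_⟩
      rw [SimpleGraph.Walk.support_concat] at hy
      simp only [List.mem_append, List.mem_singleton] at hy
      rcases hy with hy | hy
      · exact Or.inr (hlt y hy)
      · exact Or.inl hy

lemma IsStrictPO.covRel_unique_of_isAcyclic [Finite V] (h : IsStrictPO lt) {r : V}
    (hr : ∀ v, v ≠ r → lt r v) (hG : (hasseGraph lt).IsAcyclic) {a b c : V}
    (ha : CovRel lt a c) (hb : CovRel lt b c) : a = b := by
  have key : ∀ d, CovRel lt d c → ∃ p : (hasseGraph lt).Walk r c,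
      p.IsPath ∧ p.penultimate = d := fun d hd => by
    obtain ⟨p, hp, hle⟩ := h.exists_isPath_from_least hr d
    refine ⟨p.concat ((hasseGraph_adj h).2 (Or.inl hd)), hp.concat (fun hc => ?_) _, by simp⟩
    rcases hle c hc with rfl | hcd
    · exact h.1 _ hd.1
    · exact h.1 _ (h.2 _ _ _ hcd hd.1)
  obtain ⟨p, hp, rfl⟩ := key a ha
  obtain ⟨q, hq, rfl⟩ := key b hb
  have := (hG.subsingleton_path r c).elim ⟨p, hp⟩ ⟨q, hq⟩
  rw [Subtype.mk.injEq] at this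
  rw [this]

lemma IsStrictPO.comparable_of_covRel_unique [Finite V] (h : IsStrictPO lt)
    (hu : ∀ a b c, CovRel lt a c → CovRel lt b c → a = b) (c : V) :
    ∀ a b, lt a c → lt b c → a = b ∨ lt a b ∨ lt b a := by
  induction c using h.wellFounded.induction with
  | _ c ih =>
    intro a b ha hb
    obtain ⟨p, hap, hp⟩ := h.exists_covRel ha
    obtain ⟨q, hbq, hq⟩ := h.exists_covRel hb
    obtain rfl := hu p q c hp hq
    have := ih p hp.1 a b
    grind

lemma IsStrictPO.isAcyclic_hasseGraph [Finite V] (h : IsStrictPO lt)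
    (hu : ∀ a b c, CovRel lt a c → CovRel lt b c → a = b) : (hasseGraph lt).IsAcyclic := by
  classical
  intro v c hc
  obtain ⟨m, hm, hmax⟩ := h.swap.wellFounded.has_min {x | x ∈ c.support}
    ⟨v, c.start_mem_support⟩
  have hc' := hc.rotate hm
  have hcov : ∀ x ∈ (c.rotate m hm).support, (hasseGraph lt).Adj m x → CovRel lt x m := by
    intro x hx hadj
    rw [SimpleGraph.Walk.mem_support_rotate_iff] at hx
    rcases (hasseGraph_adj h).1 hadj with hmx | hxm
    · exact absurd hmx.1 (hmax x hx)
    · exact hxm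
  refine hc'.snd_ne_penultimate (hu _ _ m (hcov _ ?_ ?_) (hcov _ ?_ ?_))
  · exact SimpleGraph.Walk.getVert_mem_support _ _
  · exact SimpleGraph.Walk.adj_snd hc'.not_nil
  · exact SimpleGraph.Walk.getVert_mem_support _ _
  · exact (SimpleGraph.Walk.adj_penultimate hc'.not_nil).symm

lemma IsStrictPO.isTree_hasseGraph [Finite V] (h : IsStrictPO lt) {r : V}
    (hr : ∀ v, v ≠ r → lt r v)
    (hchain : ∀ a b c, lt a c → lt b c → a = b ∨ lt a b ∨ lt b a) :
    (hasseGraph lt).IsTree := by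
  refine ⟨(SimpleGraph.connected_iff_exists_forall_reachable _).2 ⟨r, fun x => ?_⟩,
    h.isAcyclic_hasseGraph fun a b c ha hb => ?_⟩
  · obtain ⟨p, -⟩ := h.exists_isPath_from_least hr x
    exact ⟨p⟩
  · rcases hchain a b c ha.1 hb.1 with hab | hab | hba
    · exact hab
    · exact absurd hb.1 (ha.2 b hab)
    · exact absurd ha.1 (hb.2 a hba)

/-- In the comparability graph of an order whose lower sets are chains, a three-edge walk has
a chord joining vertices at distance two. -/
lemma adj_or_adj_of_chain {G : SimpleGraph V} (h : IsStrictPO lt)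
    (hG : ∀ a b, G.Adj a b ↔ (lt a b ∨ lt b a))
    (hchain : ∀ a b c, lt a c → lt b c → a = b ∨ lt a b ∨ lt b a) {a b c d : V}
    (hac : a ≠ c) (hbd : b ≠ d) (hab : G.Adj a b) (hbc : G.Adj b c) (hcd : G.Adj c d) :
    G.Adj a c ∨ G.Adj b d := by
  have ht := h.2
  simp only [hG] at *
  rcases hbc with hbc | hcb
  · right
    rcases hcd with hcd | hdc
    · exact Or.inl (ht _ _ _ hbc hcd)
    · exact (hchain b d c hbc hdc).resolve_left hbd
  · left
    rcases hab with hab | hba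
    · exact (hchain a c b hab hcb).resolve_left hac
    · exact Or.inr (ht _ _ _ hcb hba)

end TreeOrders

section NeighborhoodOrder

variable {V : Type*} {G : SimpleGraph V}

/-- Adjacent vertices ordered by reverse inclusion of closed neighborhoods, with ties broken
by the index `e`. -/
def nbhdLT (G : SimpleGraph V) (e : V → ℕ) (x y : V) : Prop :=
  G.Adj x y ∧ (∀ z, G.Adj y z → z = x ∨ G.Adj x z) ∧
    ((∀ z, G.Adj x z → z = y ∨ G.Adj y z) → e x < e y)

lemma isStrictPO_nbhdLT (e : V → ℕ) : IsStrictPO (nbhdLT G e) := by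
  refine ⟨fun a h => G.loopless.irrefl a h.1, ?_⟩
  rintro x y z ⟨hxy, hyx, he⟩ ⟨hyz, hzy, he'⟩
  have hxz : x ≠ z := by
    rintro rfl
    exact lt_asymm (he hzy) (he' hyx)
  have hadj : G.Adj x z := (hyx z hyz).resolve_left hxz.symm
  refine ⟨hadj, fun w hw => ?_, fun hsub => ?_⟩
  · rcases hzy w hw with rfl | hw
    · exact Or.inr hxy
    · exact hyx w hw
  · refine (he fun w hw => ?_).trans (he' fun w hw => ?_)
    · rcases hsub w hw with rfl | hw
      · exact Or.inr hyz
      · exact hzy w hw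
    · rcases hyx w hw with rfl | hw
      · exact Or.inr hadj.symm
      · exact hsub w hw

lemma adj_iff_nbhdLT (hC : C4Free G) (hP : P4Free G) {e : V → ℕ}
    (he : Function.Injective e) (x y : V) :
    G.Adj x y ↔ nbhdLT G e x y ∨ nbhdLT G e y x := by
  refine ⟨fun hxy => ?_, fun h => h.elim (·.1) (·.1.symm)⟩
  have hne := he.ne hxy.ne
  have hsub : (∀ z, G.Adj y z → z = x ∨ G.Adj x z) ∨ (∀ z, G.Adj x z → z = y ∨ G.Adj y z) := by
    by_contra! hcon
    obtain ⟨⟨b, hyb, hbx, hxb⟩, a, hxa, hay, hya⟩ := hcon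
    have hab : a ≠ b := by
      rintro rfl
      exact hya hyb
    by_cases hadj : G.Adj a b
    · exact hC ⟨a, x, y, b, hxa.ne', hay, hab, hxy.ne, hbx.symm, hyb.ne, hxa.symm, hxy, hyb,
        hadj.symm, fun h => hya h.symm, hxb⟩
    · exact hP ⟨a, x, y, b, hxa.ne', hay, hab, hxy.ne, hbx.symm, hyb.ne, hxa.symm, hxy, hyb,
        fun h => hya h.symm, hadj, hxb⟩
  have hyx := hxy.symm
  unfold nbhdLT
  by_cases h1 : ∀ z, G.Adj y z → z = x ∨ G.Adj x z <;>
    by_cases h2 : ∀ z, G.Adj x z → z = y ∨ G.Adj y z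
  · rcases lt_or_gt_of_ne hne with hlt | hlt
    · exact Or.inl ⟨hxy, h1, fun _ => hlt⟩
    · exact Or.inr ⟨hyx, h2, fun _ => hlt⟩
  · exact Or.inl ⟨hxy, h1, fun h => absurd h h2⟩
  · exact Or.inr ⟨hyx, h2, fun h => absurd h h1⟩
  · exact absurd hsub (not_or.2 ⟨h1, h2⟩)

/-- In a connected comparability graph of a finite order whose lower sets are chains, the order
has a least element. -/
lemma IsStrictPO.exists_least_of_connected [Finite V] {lt : V → V → Prop} (h : IsStrictPO lt)
    (hG : ∀ a b, G.Adj a b ↔ (lt a b ∨ lt b a))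
    (hchain : ∀ a b c, lt a c → lt b c → a = b ∨ lt a b ∨ lt b a) (hconn : G.Connected) :
    ∃ r, ∀ v, v ≠ r → lt r v := by
  obtain ⟨v₀⟩ := hconn.nonempty
  obtain ⟨r, -, hmin⟩ := h.wellFounded.has_min Set.univ ⟨v₀, trivial⟩
  have hstep : ∀ v w, G.Adj v w → (v = r ∨ lt r v) → w = r ∨ lt r w := by
    intro v w hvw hv
    have ht := h.2
    have := hmin w trivial
    rcases (hG v w).1 hvw with hvw | hwv
    · rcases hv with rfl | hv
      · exact Or.inr hvw
      · exact Or.inr (ht _ _ _ hv hvw)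
    · rcases hv with rfl | hv
      · exact absurd hwv this
      · have := hchain r w v hv hwv
        grind
  refine ⟨r, fun v hv => ?_⟩
  have hreach := (SimpleGraph.reachable_iff_reflTransGen r v).1 (hconn.preconnected r v)
  have : v = r ∨ lt r v := by
    clear hv
    induction hreach with
    | refl => exact Or.inl rfl
    | tail _ hadj ih => exact hstep _ _ hadj ih
  exact this.resolve_left hv

end NeighborhoodOrder

/-- A connected graph is an arborescence iff it is `C4`-free and `P4`-free. -/
theorem arborescence_iff_C4Free_P4Free
    {V : Type*} [Fintype V] (G : SimpleGraph V) (hconn : G.Connected) :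
    IsArborescence G ↔ (C4Free G ∧ P4Free G) := by
  constructor
  · intro hA
    obtain ⟨lt, ⟨hpo, hG, htree⟩, r, hr⟩ : ∃ lt : V → V → Prop,
        IsTreelikeOrientation G lt ∧ ∃ r : V, ∀ v : V, v ≠ r → lt r v := by
      obtain ⟨lt, hlt, r, hr | hr⟩ := hA
      · exact ⟨fun a b => lt b a, hlt.swap, r, hr⟩
      · exact ⟨lt, hlt, r, hr⟩
    have hchain : ∀ a b c, lt a c → lt b c → a = b ∨ lt a b ∨ lt b a := fun a b c =>
      hpo.comparable_of_covRel_unique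
        (fun _ _ _ ha hb => hpo.covRel_unique_of_isAcyclic hr htree.isAcyclic ha hb) c a b
    constructor
    · rintro ⟨a, b, c, d, -, hac, -, -, hbd, -, hab, hbc, hcd, -, nac, nbd⟩
      exact (adj_or_adj_of_chain hpo hG hchain hac hbd hab hbc hcd).elim nac nbd
    · rintro ⟨a, b, c, d, -, hac, -, -, hbd, -, hab, hbc, hcd, nac, -, nbd⟩
      exact (adj_or_adj_of_chain hpo hG hchain hac hbd hab hbc hcd).elim nac nbd
  · rintro ⟨hC, hP⟩
    obtain ⟨e, he⟩ : ∃ e : V → ℕ, Function.Injective e :=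
      ⟨fun v => Fintype.equivFin V v,
        fun _ _ h => (Fintype.equivFin V).injective (Fin.val_injective h)⟩
    have hpo := isStrictPO_nbhdLT (G := G) e
    have hG := adj_iff_nbhdLT hC hP he
    have hchain : ∀ a b c, nbhdLT G e a c → nbhdLT G e b c →
        a = b ∨ nbhdLT G e a b ∨ nbhdLT G e b a := by
      intro a b c hac hbc
      rw [← hG a b]
      exact (hbc.2.1 a hac.1.symm).imp_right (·.symm)
    obtain ⟨r, hr⟩ := hpo.exists_least_of_connected hG hchain hconn
    exact ⟨nbhdLT G e, ⟨hpo, hG, hpo.isTree_hasseGraph hr hchain⟩, r, Or.inr hr⟩
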